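/- arXiv:0903.1430 — 6 statements merged into one kernel-verified Lean document; each statement's English description precedes it below -/
import Mathlib

section
/- Let s, t be real numbers with s ≠ t and |t − s| < 1, and let α = min{s, t}. Then the function Δ_{s,t}(x) = [(ψ(x+t) − ψ(x+s))/(t − s)]² + (ψ'(x+t) − ψ'(x+s))/(t − s) is completely monotonic on the interval (−α, ∞); that is, for every nonnegative integer n and every x > −α, (−1)^n Δ_{s,t}^{(n)}(x) ≥ 0. -/
/-- The digamma function `ψ = Γ'/Γ`, as the derivative of `log ∘ Γ`. -/
noncomputable def digamma (x : ℝ) : ℝ := deriv (fun y : ℝ => Real.log (Real.Gamma y)) x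

/-- The trigamma function `ψ'`. -/
noncomputable def trigamma (x : ℝ) : ℝ := deriv digamma x

open Set Filter Topology

/-- `f` is nonnegative on `(0, ∞)`, and so are `-f'`, `f''`, …, `(-1)^n f^(n)`, the derivatives
being genuine. -/
def CompletelyMonotoneUpTo : ℕ → (ℝ → ℝ) → Prop
  | 0, f => ∀ u > 0, 0 ≤ f u
  | n + 1, f => (∀ u > 0, 0 ≤ f u ∧ DifferentiableAt ℝ f u) ∧
      CompletelyMonotoneUpTo n (fun u => -deriv f u)

namespace CompletelyMonotoneUpTo

variable {n : ℕ} {f g : ℝ → ℝ}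

theorem nonneg (hf : CompletelyMonotoneUpTo n f) {u : ℝ} (hu : 0 < u) : 0 ≤ f u := by
  cases n with
  | zero => exact hf u hu
  | succ n => exact (hf.1 u hu).1

theorem differentiableAt (hf : CompletelyMonotoneUpTo (n + 1) f) {u : ℝ} (hu : 0 < u) :
    DifferentiableAt ℝ f u :=
  (hf.1 u hu).2

theorem of_succ (hf : CompletelyMonotoneUpTo (n + 1) f) : CompletelyMonotoneUpTo n f := by
  induction n generalizing f with
  | zero => exact fun u hu => (hf.1 u hu).1
  | succ n ih => exact ⟨hf.1, ih hf.2⟩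

theorem deriv_congr_Ioi (h : ∀ u > 0, f u = g u) {u : ℝ} (hu : 0 < u) : deriv f u = deriv g u :=
  Filter.EventuallyEq.deriv_eq ((eventually_gt_nhds hu).mono h)

theorem congr (hf : CompletelyMonotoneUpTo n f) (h : ∀ u > 0, f u = g u) :
    CompletelyMonotoneUpTo n g := by
  induction n generalizing f g with
  | zero => exact fun u hu => h u hu ▸ hf u hu
  | succ n ih =>
    refine ⟨fun u hu => ⟨h u hu ▸ (hf.1 u hu).1, ?_⟩,
      ih hf.2 fun u hu => by rw [deriv_congr_Ioi h hu]⟩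
    exact (hf.1 u hu).2.congr_of_eventuallyEq
      ((eventually_gt_nhds hu).mono fun v hv => (h v hv).symm)

theorem add (hf : CompletelyMonotoneUpTo n f) (hg : CompletelyMonotoneUpTo n g) :
    CompletelyMonotoneUpTo n (fun u => f u + g u) := by
  induction n generalizing f g with
  | zero => exact fun u hu => add_nonneg (hf u hu) (hg u hu)
  | succ n ih =>
    refine ⟨fun u hu => ⟨add_nonneg (hf.nonneg hu) (hg.nonneg hu),
      (hf.differentiableAt hu).add (hg.differentiableAt hu)⟩,
      (ih hf.2 hg.2).congr fun u hu => ?_⟩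
    rw [deriv_fun_add (hf.differentiableAt hu) (hg.differentiableAt hu)]
    ring

theorem mul (hf : CompletelyMonotoneUpTo n f) (hg : CompletelyMonotoneUpTo n g) :
    CompletelyMonotoneUpTo n (fun u => f u * g u) := by
  induction n generalizing f g with
  | zero => exact fun u hu => mul_nonneg (hf u hu) (hg u hu)
  | succ n ih =>
    refine ⟨fun u hu => ⟨mul_nonneg (hf.nonneg hu) (hg.nonneg hu),
      (hf.differentiableAt hu).mul (hg.differentiableAt hu)⟩,
      ((ih hf.2 hg.of_succ).add (ih hf.of_succ hg.2)).congr fun u hu => ?_⟩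
    rw [deriv_fun_mul (hf.differentiableAt hu) (hg.differentiableAt hu)]
    ring

theorem const {a : ℝ} (ha : 0 ≤ a) : CompletelyMonotoneUpTo n (fun _ => a) := by
  induction n generalizing a with
  | zero => exact fun _ _ => ha
  | succ n ih => exact ⟨fun u _ => ⟨ha, by fun_prop⟩, (ih le_rfl).congr fun u _ => by simp⟩

theorem comp_add_const {a : ℝ} (ha : 0 ≤ a) (hf : CompletelyMonotoneUpTo n f) :
    CompletelyMonotoneUpTo n (fun u => f (u + a)) := by
  induction n generalizing f with
  | zero => exact fun u hu => hf _ (by linarith)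
  | succ n ih =>
    refine ⟨fun u hu => ⟨hf.nonneg (by linarith), ?_⟩, (ih hf.2).congr fun u _ => ?_⟩
    · exact (differentiableAt_comp_add_const).2 (hf.differentiableAt (by linarith))
    · rw [deriv_comp_add_const]

theorem inv : CompletelyMonotoneUpTo n (fun u => u⁻¹) := by
  induction n with
  | zero => exact fun u hu => inv_nonneg.2 hu.le
  | succ n ih =>
    refine ⟨fun u hu => ⟨inv_nonneg.2 hu.le, differentiableAt_inv hu.ne'⟩,
      (ih.mul ih).congr fun u _ => ?_⟩
    rw [deriv_inv, neg_neg, sq, mul_inv]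

theorem neg_one_pow_mul_iteratedDeriv_nonneg (hf : CompletelyMonotoneUpTo n f) {u : ℝ}
    (hu : 0 < u) : 0 ≤ (-1 : ℝ) ^ n * iteratedDeriv n f u := by
  induction n generalizing f with
  | zero => simpa using hf u hu
  | succ n ih =>
    have h := ih hf.2
    rw [iteratedDeriv_fun_neg] at h
    rw [iteratedDeriv_succ', pow_succ]
    linarith

theorem deriv_monotoneOn (hf : CompletelyMonotoneUpTo 2 f) : MonotoneOn (deriv f) (Ioi 0) := by
  have hd : ∀ u > 0, DifferentiableAt ℝ (fun v => -deriv f v) u := fun u hu =>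
    hf.2.differentiableAt hu
  have h : AntitoneOn (fun v => -deriv f v) (Ioi 0) := by
    refine antitoneOn_of_deriv_nonpos (convex_Ioi 0)
      (fun u hu => (hd u hu).continuousAt.continuousWithinAt) ?_ ?_
    · rw [interior_Ioi]
      exact fun u hu => (hd u hu).differentiableWithinAt
    · rw [interior_Ioi]
      exact fun u hu => neg_nonneg.1 (hf.2.2 u hu)
  exact fun u hu v hv huv => neg_le_neg_iff.1 (h hu hv huv)

theorem neg_deriv_le (hf : CompletelyMonotoneUpTo 2 f) {u : ℝ} (hu : 0 < u) :
    -deriv f u ≤ f (u / 2) * (2 / u) := by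
  have hd : ∀ v ∈ Icc (u / 2) u, DifferentiableAt ℝ f v := fun v hv =>
    hf.differentiableAt ((half_pos hu).trans_le hv.1)
  obtain ⟨v, hv, h⟩ := exists_deriv_eq_slope f (half_lt_self hu)
    (fun v hv => (hd v hv).continuousAt.continuousWithinAt)
    (fun v hv => (hd v (Ioo_subset_Icc_self hv)).differentiableWithinAt)
  have hvu := hf.deriv_monotoneOn (show v ∈ Ioi 0 from (half_pos hu).trans hv.1)
    (show u ∈ Ioi 0 from hu) hv.2.le
  have hfu := hf.nonneg hu
  have hs : (f u - f (u / 2)) / (u - u / 2) = f u * (2 / u) - f (u / 2) * (2 / u) := by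
    have := hu.ne'
    field_simp
    ring
  have : 0 ≤ f u * (2 / u) := by positivity
  linarith

theorem tendsto_deriv_atTop (hf : CompletelyMonotoneUpTo 2 f) (h : Tendsto f atTop (𝓝 0)) :
    Tendsto (deriv f) atTop (𝓝 0) := by
  have hlim : Tendsto (fun u : ℝ => f (u / 2) * (2 / u)) atTop (𝓝 0) := by
    simpa using (h.comp (tendsto_id.atTop_div_const two_pos)).mul
      (tendsto_const_nhds.div_atTop tendsto_id : Tendsto (fun u : ℝ => 2 / u) atTop (𝓝 0))
  have : Tendsto (fun u => -deriv f u) atTop (𝓝 0) := by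
    refine tendsto_of_tendsto_of_tendsto_of_le_of_le' tendsto_const_nhds hlim ?_ ?_
    · exact (eventually_gt_atTop 0).mono fun u hu => hf.2.nonneg hu
    · exact (eventually_gt_atTop 0).mono fun u hu => hf.neg_deriv_le hu
  simpa using this.neg

theorem tsum {f : ℕ → ℝ → ℝ} (hf : ∀ k n, CompletelyMonotoneUpTo n (f k))
    (hs : ∀ u > 0, Summable fun k => f k u) :
    CompletelyMonotoneUpTo n (fun u => ∑' k, f k u) := by
  induction n generalizing f with
  | zero => exact fun u hu => tsum_nonneg fun k => (hf k 0).nonneg hu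
  | succ n ih =>
    have hs' : ∀ u > 0, Summable fun k => -deriv (f k) u := fun u hu =>
      Summable.of_nonneg_of_le (fun k => (hf k 1).2.nonneg hu)
        (fun k => (hf k 2).neg_deriv_le hu) ((hs _ (half_pos hu)).mul_right _)
    have hd : ∀ u > 0, HasDerivAt (fun v => ∑' k, f k v) (∑' k, deriv (f k) u) u := fun u hu => by
      refine hasDerivAt_tsum_of_isPreconnected (hs' _ (half_pos hu)) (t := Ioi (u / 2)) (y₀ := u)
        isOpen_Ioi isPreconnected_Ioi
        (fun k v hv => ((hf k 1).differentiableAt ((half_pos hu).trans hv)).hasDerivAt)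
        (fun k v hv => ?_) (half_lt_self hu) (hs u hu) (half_lt_self hu)
      have hv0 : 0 < v := (half_pos hu).trans hv
      have h0 := (hf k 1).2.nonneg hv0
      have h1 := (hf k 2).deriv_monotoneOn (half_pos hu) hv0 (le_of_lt hv)
      rw [Real.norm_eq_abs, abs_of_nonpos (by linarith)]
      exact neg_le_neg h1
    refine ⟨fun u hu => ⟨tsum_nonneg fun k => (hf k 0).nonneg hu, (hd u hu).differentiableAt⟩,
      (ih (fun k n => (hf k (n + 1)).2) hs').congr fun u hu => ?_⟩
    rw [(hd u hu).deriv, tsum_neg]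

/-- A function vanishing at infinity whose backward unit difference is completely monotonic is
itself completely monotonic. -/
theorem of_sub_add_one {r : ℝ → ℝ} (hr : ∀ n, CompletelyMonotoneUpTo n r)
    (hf : Tendsto f atTop (𝓝 0)) (h : ∀ u > 0, f u - f (u + 1) = r u) :
    CompletelyMonotoneUpTo n f := by
  have hsum : ∀ u > 0, HasSum (fun k : ℕ => r (u + k)) (f u) := fun u hu => by
    rw [hasSum_iff_tendsto_nat_of_nonneg fun k => (hr 0).nonneg (by positivity)]
    have hpart : ∀ m : ℕ, ∑ k ∈ Finset.range m, r (u + k) = f u - f (u + m) := fun m => by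
      induction m with
      | zero => simp
      | succ m ih =>
        rw [Finset.sum_range_succ, ih, ← h _ (by positivity)]
        push_cast
        ring_nf
    simp_rw [hpart]
    simpa using tendsto_const_nhds.sub
      (hf.comp (tendsto_atTop_add_const_left _ u tendsto_natCast_atTop_atTop))
  exact (tsum (fun k n => (hr n).comp_add_const k.cast_nonneg) fun u hu =>
    (hsum u hu).summable).congr fun u hu => (hsum u hu).tsum_eq

end CompletelyMonotoneUpTo

theorem Real.analyticAt_Gamma {u : ℝ} (hu : 0 < u) : AnalyticAt ℝ Real.Gamma u := by
  have hopen : IsOpen {z : ℂ | 0 < z.re} := isOpen_lt continuous_const Complex.continuous_re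
  have hd : DifferentiableOn ℂ Complex.Gamma {z : ℂ | 0 < z.re} := fun z hz =>
    (Complex.differentiableAt_Gamma z fun m hm => by
      rw [hm] at hz
      have : (0 : ℝ) ≤ m := m.cast_nonneg
      simp at hz
      linarith).differentiableWithinAt
  have h := (hd.analyticAt (hopen.mem_nhds (show (u : ℂ) ∈ {z : ℂ | 0 < z.re} by simpa))).re_ofReal
  simpa [Complex.Gamma_ofReal] using h

theorem analyticAt_log_Gamma {u : ℝ} (hu : 0 < u) :
    AnalyticAt ℝ (fun y => Real.log (Real.Gamma y)) u :=
  (Real.analyticAt_Gamma hu).log (Real.Gamma_pos_of_pos hu)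

theorem differentiableAt_digamma {u : ℝ} (hu : 0 < u) : DifferentiableAt ℝ digamma u :=
  (analyticAt_log_Gamma hu).deriv.differentiableAt

theorem digamma_add_one {u : ℝ} (hu : 0 < u) : digamma (u + 1) = digamma u + u⁻¹ := by
  unfold digamma
  rw [← deriv_comp_add_const, ← Real.deriv_log u,
    ← deriv_fun_add (analyticAt_log_Gamma hu).differentiableAt
      (Real.differentiableAt_log hu.ne')]
  refine CompletelyMonotoneUpTo.deriv_congr_Ioi (fun v hv => ?_) hu
  rw [Real.Gamma_add_one hv.ne', Real.log_mul hv.ne' (Real.Gamma_pos_of_pos hv).ne', add_comm]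

theorem monotoneOn_digamma : MonotoneOn digamma (Ioi 0) :=
  Real.convexOn_log_Gamma.monotoneOn_deriv fun _ hu => (analyticAt_log_Gamma hu).differentiableAt

/-- The divided difference of the digamma function with step `c`. -/
noncomputable def digammaSlope (c u : ℝ) : ℝ := (digamma (u + c) - digamma u) / c

section digammaSlope

variable {c u : ℝ}

theorem hasDerivAt_digammaSlope (hc : 0 < c) (hu : 0 < u) :
    HasDerivAt (digammaSlope c) ((trigamma (u + c) - trigamma u) / c) u :=
  (((differentiableAt_digamma (add_pos hu hc)).hasDerivAt.comp_add_const u c).sub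
    (differentiableAt_digamma hu).hasDerivAt).div_const c

theorem digammaSlope_sub_add_one (hc : 0 < c) (hu : 0 < u) :
    digammaSlope c u - digammaSlope c (u + 1) = u⁻¹ * (u + c)⁻¹ := by
  unfold digammaSlope
  rw [add_right_comm, digamma_add_one hu, digamma_add_one (add_pos hu hc)]
  have := add_pos hu hc
  field_simp
  ring

theorem tendsto_digammaSlope (hc : 0 < c) (hc1 : c < 1) :
    Tendsto (digammaSlope c) atTop (𝓝 0) := by
  have hlim : Tendsto (fun u : ℝ => u⁻¹ / c) atTop (𝓝 0) := by
    simpa using tendsto_inv_atTop_zero.div_const c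
  refine tendsto_of_tendsto_of_tendsto_of_le_of_le' tendsto_const_nhds hlim ?_ ?_
  · filter_upwards [eventually_gt_atTop 0] with u hu
    have := monotoneOn_digamma hu (add_pos hu hc) (by linarith)
    exact div_nonneg (sub_nonneg.2 this) hc.le
  · filter_upwards [eventually_gt_atTop 0] with u hu
    have h := monotoneOn_digamma (add_pos hu hc) (add_pos hu one_pos) (by linarith)
    rw [digamma_add_one hu] at h
    exact div_le_div_of_nonneg_right (by linarith) hc.le

theorem completelyMonotoneUpTo_inv_mul_inv_add (hc : 0 < c) (n : ℕ) :
    CompletelyMonotoneUpTo n (fun u => u⁻¹ * (u + c)⁻¹) :=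
  .mul .inv (.comp_add_const hc.le .inv)

theorem completelyMonotoneUpTo_digammaSlope (hc : 0 < c) (hc1 : c < 1) (n : ℕ) :
    CompletelyMonotoneUpTo n (digammaSlope c) :=
  .of_sub_add_one (completelyMonotoneUpTo_inv_mul_inv_add hc) (tendsto_digammaSlope hc hc1)
    fun _ hu => digammaSlope_sub_add_one hc hu

theorem tendsto_comp_add_const_atTop {f : ℝ → ℝ} {l : Filter ℝ} (hf : Tendsto f atTop l) (a : ℝ) :
    Tendsto (fun u => f (u + a)) atTop l :=
  hf.comp (tendsto_atTop_add_const_right _ a tendsto_id)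

theorem completelyMonotoneUpTo_digammaSlope_add_sub (hc : 0 < c) (hc1 : c < 1) (n : ℕ) :
    CompletelyMonotoneUpTo n
      (fun u => digammaSlope c u + digammaSlope c (u + 1) - u⁻¹ - (u + c)⁻¹) := by
  have hg := completelyMonotoneUpTo_inv_mul_inv_add hc
  refine .of_sub_add_one
    (fun n => (CompletelyMonotoneUpTo.const (a := 1 - c ^ 2) (by nlinarith)).mul
      ((hg n).mul ((hg n).comp_add_const zero_le_one))) ?_ fun u hu => ?_
  · have hF := tendsto_digammaSlope hc hc1
    simpa using ((hF.add (tendsto_comp_add_const_atTop hF 1)).sub tendsto_inv_atTop_zero).sub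
      (tendsto_comp_add_const_atTop tendsto_inv_atTop_zero c)
  · have h0 := digammaSlope_sub_add_one hc hu
    have h1 := digammaSlope_sub_add_one hc (add_pos hu one_pos)
    have key : u⁻¹ * (u + c)⁻¹ + (u + 1)⁻¹ * (u + 1 + c)⁻¹ - u⁻¹ + (u + 1)⁻¹ - (u + c)⁻¹
        + (u + 1 + c)⁻¹ =
        (1 - c ^ 2) * (u⁻¹ * (u + c)⁻¹ * ((u + 1)⁻¹ * (u + 1 + c)⁻¹)) := by
      have := add_pos hu hc
      field_simp
      ring
    linear_combination h0 + h1 + key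

theorem completelyMonotoneUpTo_digammaSlope_sq_add_deriv (hc : 0 < c) (hc1 : c < 1) (n : ℕ) :
    CompletelyMonotoneUpTo n (fun u => digammaSlope c u ^ 2 + deriv (digammaSlope c) u) := by
  have hF := tendsto_digammaSlope hc hc1
  refine .of_sub_add_one
    (fun n => (completelyMonotoneUpTo_inv_mul_inv_add hc n).mul
      (completelyMonotoneUpTo_digammaSlope_add_sub hc hc1 n)) ?_ fun u hu => ?_
  · simpa using (hF.pow 2).add
      ((completelyMonotoneUpTo_digammaSlope hc hc1 2).tendsto_deriv_atTop hF)
  · have huc := add_pos hu hc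
    have hdiff : ∀ v > 0, DifferentiableAt ℝ (digammaSlope c) v := fun v hv =>
      (hasDerivAt_digammaSlope hc hv).differentiableAt
    have h0 := digammaSlope_sub_add_one hc hu
    have h1 : deriv (digammaSlope c) u - deriv (digammaSlope c) (u + 1) =
        -(u⁻¹ * (u + c)⁻¹) * (u⁻¹ + (u + c)⁻¹) := by
      rw [← deriv_comp_add_const, ← deriv_fun_sub (hdiff u hu)
        (differentiableAt_comp_add_const.2 (hdiff _ (by linarith))),
        CompletelyMonotoneUpTo.deriv_congr_Ioi (fun v hv => digammaSlope_sub_add_one hc hv) hu,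
        ((hasDerivAt_inv hu.ne').fun_mul ((hasDerivAt_inv huc.ne').comp_add_const u c)).deriv]
      field_simp
      ring
    linear_combination (digammaSlope c u + digammaSlope c (u + 1)) * h0 + h1

end digammaSlope

/-- For `s ≠ t` with `|t - s| < 1`, the function
`Δ_{s,t}(x) = [(ψ(x+t) − ψ(x+s))/(t − s)]² + (ψ'(x+t) − ψ'(x+s))/(t − s)`
is completely monotonic on `(−min{s,t}, ∞)`. -/
theorem delta_completely_monotonic (s t : ℝ) (hst : s ≠ t) (h : |t - s| < 1) :
    ∀ n : ℕ, ∀ x ∈ Set.Ioi (-(min s t)),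
      0 ≤ (-1 : ℝ) ^ n *
        iteratedDeriv n
          (fun y : ℝ =>
            ((digamma (y + t) - digamma (y + s)) / (t - s)) ^ 2 +
              (trigamma (y + t) - trigamma (y + s)) / (t - s)) x := by
  wlog hlt : s < t generalizing s t
  · have hswap := this t s hst.symm (by rwa [abs_sub_comm]) (hst.lt_or_gt.resolve_left hlt)
    have hneg : ∀ a b : ℝ, (a - b) / (t - s) = (b - a) / (s - t) := fun a b => by
      rw [← neg_sub b a, ← neg_sub s t, neg_div_neg_eq]
    simp_rw [hneg]
    rwa [min_comm]
  intro n x hx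
  have hx : 0 < x + s := by
    rw [min_eq_left hlt.le, mem_Ioi] at hx
    linarith
  have hc : 0 < t - s := sub_pos.2 hlt
  have hD : CompletelyMonotoneUpTo n (fun u =>
      ((digamma (u + (t - s)) - digamma u) / (t - s)) ^ 2 +
        (trigamma (u + (t - s)) - trigamma u) / (t - s)) :=
    (completelyMonotoneUpTo_digammaSlope_sq_add_deriv hc (abs_lt.1 h).2 n).congr fun u hu => by
      rw [(hasDerivAt_digammaSlope hc hu).deriv, digammaSlope]
  have hshift := hD.neg_one_pow_mul_iteratedDeriv_nonneg hx
  rw [← congrFun (iteratedDeriv_comp_add_const n _ s) x] at hshift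
  simpa only [add_assoc, add_sub_cancel] using hshift
end

section
/- Let s, t be real numbers with s ≠ t and |t − s| < 1, and let α = min{s, t}. Then the function z_{s,t}(x) = [Γ(x+t)/Γ(x+s)]^{1/(t−s)} − x is convex and (strictly) decreasing on the interval (−α, ∞). -/
open Filter Topology Set

/-- The function `y ↦ (Γ(y + a) / Γ(y)) ^ (1 / a)`. -/
noncomputable def gammaRoot (a y : ℝ) : ℝ :=
  (Real.Gamma (y + a) / Real.Gamma y) ^ (1 / a)

/-- Product approximations of `gammaRoot a`, obtained by iterating its functional equation. -/
noncomputable def gammaRootApprox (a : ℝ) : ℕ → ℝ → ℝ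
  | 0, y => y - 1
  | n + 1, y => (y / (y + a)) ^ (1 / a) * gammaRootApprox a n (y + 1)

/-- `H` is positive on `(1, ∞)` and its logarithmic derivative `u` satisfies the Riccati inequality
`0 ≤ u ^ 2 + u'` as well as a lower bound that makes this inequality stable under
`H ↦ (y / (y + a)) ^ (1 / a) * H (y + 1)`. -/
def IsRiccatiOn (a : ℝ) (H u w : ℝ → ℝ) : Prop :=
  ∀ y, 1 < y → 0 < H y ∧ HasDerivAt H (H y * u y) y ∧ HasDerivAt u (w y) y ∧
    0 ≤ u y ^ 2 + w y ∧ (2 * y + a - 3) / (2 * ((y - 1) * (y - 1 + a))) ≤ u y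

section

variable {a : ℝ}

lemma gammaRoot_pos (ha : 0 < a) {y : ℝ} (hy : 0 < y) : 0 < gammaRoot a y :=
  Real.rpow_pos_of_pos
    (div_pos (Real.Gamma_pos_of_pos (by linarith)) (Real.Gamma_pos_of_pos hy)) _

lemma gammaRoot_eq_mul (ha : 0 < a) {y : ℝ} (hy : 0 < y) :
    gammaRoot a y = (y / (y + a)) ^ (1 / a) * gammaRoot a (y + 1) := by
  have hya : 0 < y + a := by linarith
  have h1 := Real.Gamma_pos_of_pos hy
  have h2 := Real.Gamma_pos_of_pos hya
  have h3 : Real.Gamma (y + 1 + a) = (y + a) * Real.Gamma (y + a) := by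
    rw [← Real.Gamma_add_one hya.ne']; ring_nf
  unfold gammaRoot
  rw [h3, Real.Gamma_add_one hy.ne', ← Real.mul_rpow (by positivity) (by positivity)]
  congr 1
  field_simp

lemma gammaRoot_le (ha : 0 < a) (ha1 : a < 1) {y : ℝ} (hy : 0 < y) : gammaRoot a y ≤ y := by
  have h1 := Real.Gamma_pos_of_pos hy
  have key := Real.Gamma_mul_add_mul_le_rpow_Gamma_mul_rpow_Gamma hy
    (show (0 : ℝ) < y + 1 by linarith) (sub_pos.mpr ha1) ha (by ring)
  rw [Real.Gamma_add_one hy.ne', Real.mul_rpow hy.le h1.le, mul_left_comm,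
    ← Real.rpow_add h1, sub_add_cancel, Real.rpow_one,
    show (1 - a) * y + a * (y + 1) = y + a by ring] at key
  have h2 : 0 ≤ Real.Gamma (y + a) := (Real.Gamma_pos_of_pos (by linarith)).le
  rw [gammaRoot, one_div, Real.rpow_inv_le_iff_of_pos (by positivity) hy.le ha]
  rwa [div_le_iff₀ h1]

lemma le_gammaRoot (ha : 0 < a) (ha1 : a < 1) {y : ℝ} (hy : 0 < y) :
    (y / (y + a)) ^ (1 / a) * (y + a) ≤ gammaRoot a y := by
  have hya : 0 < y + a := by linarith
  have h1 := Real.Gamma_pos_of_pos hy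
  have h2 := Real.Gamma_pos_of_pos hya
  have key := Real.Gamma_mul_add_mul_le_rpow_Gamma_mul_rpow_Gamma hya
    (show (0 : ℝ) < y + a + 1 by linarith) ha (sub_pos.mpr ha1) (by ring)
  rw [Real.Gamma_add_one hya.ne', Real.mul_rpow hya.le h2.le, mul_left_comm,
    ← Real.rpow_add h2, add_sub_cancel, Real.rpow_one,
    show a * (y + a) + (1 - a) * (y + a + 1) = y + 1 by ring, Real.Gamma_add_one hy.ne',
    Real.rpow_sub hya, Real.rpow_one] at key
  have hp : 0 < (y + a) ^ a := Real.rpow_pos_of_pos hya _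
  calc (y / (y + a)) ^ (1 / a) * (y + a)
      = (y / (y + a)) ^ (1 / a) * ((y + a) ^ a) ^ (1 / a) := by
        rw [one_div, Real.rpow_rpow_inv hya.le ha.ne']
    _ = (y / (y + a) * (y + a) ^ a) ^ (1 / a) := by
        rw [Real.mul_rpow (by positivity) (by positivity)]
    _ ≤ gammaRoot a y := by
        unfold gammaRoot
        refine Real.rpow_le_rpow (by positivity) ?_ (by positivity)
        rw [le_div_iff₀ h1]
        calc y / (y + a) * (y + a) ^ a * Real.Gamma y
            = (y * Real.Gamma y) * ((y + a) ^ a / (y + a)) := by ring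
          _ ≤ ((y + a) / (y + a) ^ a * Real.Gamma (y + a)) * ((y + a) ^ a / (y + a)) := by
              gcongr
          _ = Real.Gamma (y + a) := by field_simp

lemma tendsto_gammaRoot_div_atTop (ha : 0 < a) (ha1 : a < 1) :
    Tendsto (fun y => gammaRoot a y / y) atTop (𝓝 1) := by
  have hinv : Tendsto (fun y : ℝ => 1 + a / y) atTop (𝓝 1) := by
    simpa using (tendsto_const_nhds (x := (1 : ℝ))).add
      ((tendsto_const_nhds (x := a)).div_atTop tendsto_id)
  have hlow : Tendsto (fun y : ℝ => ((1 + a / y)⁻¹) ^ (1 / a) * (1 + a / y)) atTop (𝓝 1) := by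
    have := ((hinv.inv₀ one_ne_zero).rpow_const (p := 1 / a) (Or.inl (by simp))).mul hinv
    simpa using this
  refine tendsto_of_tendsto_of_tendsto_of_le_of_le' hlow tendsto_const_nhds ?_ ?_
  · filter_upwards [eventually_gt_atTop 0] with y hy
    rw [le_div_iff₀ hy]
    refine le_trans (le_of_eq ?_) (le_gammaRoot ha ha1 hy)
    have h1 : 1 + a / y = (y + a) / y := by field_simp
    rw [h1, inv_div]
    field_simp
  · filter_upwards [eventually_gt_atTop 0] with y hy
    exact div_le_one_of_le₀ (gammaRoot_le ha ha1 hy) hy.le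

lemma gammaRootApprox_mul (ha : 0 < a) (n : ℕ) {y : ℝ} (hy : 0 < y) :
    gammaRootApprox a n y * gammaRoot a (y + n) = gammaRoot a y * (y + n - 1) := by
  induction n generalizing y with
  | zero => simp [gammaRootApprox, mul_comm]
  | succ n ih =>
    have := ih (y := y + 1) (by linarith)
    rw [gammaRootApprox, gammaRoot_eq_mul ha hy]
    push_cast
    rw [show y + ((n : ℝ) + 1) = y + 1 + n by ring]
    linear_combination (y / (y + a)) ^ (1 / a) * this

lemma tendsto_gammaRootApprox (ha : 0 < a) (ha1 : a < 1) {y : ℝ} (hy : 0 < y) :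
    Tendsto (fun n => gammaRootApprox a n y) atTop (𝓝 (gammaRoot a y)) := by
  have hadd : Tendsto (fun n : ℕ => y + (n : ℝ)) atTop atTop :=
    tendsto_atTop_add_const_left _ _ tendsto_natCast_atTop_atTop
  have hsub : Tendsto (fun x : ℝ => 1 - 1 / x) atTop (𝓝 1) := by
    simpa using (tendsto_const_nhds (x := (1 : ℝ))).sub
      ((tendsto_const_nhds (x := (1 : ℝ))).div_atTop tendsto_id)
  have hquot := ((hsub.div (tendsto_gammaRoot_div_atTop ha ha1) one_ne_zero).comp hadd).const_mul
    (gammaRoot a y)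
  rw [div_one, mul_one] at hquot
  refine hquot.congr fun n => ?_
  have hyn : 0 < y + n := by positivity
  have hpos := gammaRoot_pos ha hyn
  have := gammaRootApprox_mul ha n hy
  simp only [Function.comp_apply, Pi.div_apply]
  rw [← mul_right_cancel_iff_of_pos hpos, this]
  field_simp

lemma hasDerivAt_div_add_rpow (ha : 0 < a) {y : ℝ} (hy : 0 < y) :
    HasDerivAt (fun y => (y / (y + a)) ^ (1 / a))
      ((y / (y + a)) ^ (1 / a) * (1 / (y * (y + a)))) y := by
  have hya : 0 < y + a := by linarith
  have hq : 0 < y / (y + a) := by positivity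
  have := ((hasDerivAt_id y).div ((hasDerivAt_id y).add_const a) hya.ne').rpow_const
    (p := 1 / a) (Or.inl hq.ne')
  refine this.congr_deriv ?_
  simp only [Pi.div_apply, id]
  rw [Real.rpow_sub hq, Real.rpow_one]
  field_simp
  ring

lemma IsRiccatiOn.step (ha : 0 < a) {H u w : ℝ → ℝ} (h : IsRiccatiOn a H u w)
    {y : ℝ} (hy : 0 < y) :
    let K := fun y => (y / (y + a)) ^ (1 / a) * H (y + 1)
    let v := fun y => 1 / (y * (y + a)) + u (y + 1)
    let v' := fun y => -(2 * y + a) / (y * (y + a)) ^ 2 + w (y + 1)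
    0 < K y ∧ HasDerivAt K (K y * v y) y ∧ HasDerivAt v (v' y) y ∧ 0 ≤ v y ^ 2 + v' y ∧
      (2 * y + a + 1) / (2 * (y * (y + a))) ≤ v y := by
  intro K v v'
  have hya : 0 < y + a := by linarith
  obtain ⟨hH, hH', hu', hric, hbd⟩ := h (y + 1) (by linarith)
  have hP : 0 < y * (y + a) := by positivity
  have hbd' : (2 * y + a - 1) / (2 * (y * (y + a))) ≤ u (y + 1) := by
    convert hbd using 2 <;> ring
  refine ⟨by positivity, ?_, ?_, ?_, ?_⟩
  · have := (hasDerivAt_div_add_rpow ha hy).mul (hH'.comp_add_const y 1)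
    refine this.congr_deriv ?_
    simp only [K, v]
    ring
  · have h1 : HasDerivAt (fun y : ℝ => y * (y + a)) (2 * y + a) y := by
      refine ((hasDerivAt_id y).mul ((hasDerivAt_id y).add_const a)).congr_deriv ?_
      simp only [id]
      ring
    have h2 := (h1.inv hP.ne').add (hu'.comp_add_const y 1)
    simp only [v, one_div]
    exact h2
  · have h1 : v y ^ 2 + v' y = (u (y + 1) ^ 2 + w (y + 1)) +
        2 / (y * (y + a)) * (u (y + 1) - (2 * y + a - 1) / (2 * (y * (y + a)))) := by
      simp only [v, v']
      field_simp
      ring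
    rw [h1]
    have := sub_nonneg.mpr hbd'
    positivity
  · have h1 : (2 * y + a + 1) / (2 * (y * (y + a))) =
        1 / (y * (y + a)) + (2 * y + a - 1) / (2 * (y * (y + a))) := by
      field_simp
      ring
    rw [h1]
    simp only [v]
    gcongr

lemma exists_isRiccatiOn_gammaRootApprox (ha : 0 < a) (ha1 : a < 1) (n : ℕ) :
    ∃ u w, IsRiccatiOn a (gammaRootApprox a n) u w := by
  induction n with
  | zero =>
    refine ⟨fun y => (y - 1)⁻¹, fun y => -1 / (y - 1) ^ 2, fun y hy => ?_⟩
    have hy1 : 0 < y - 1 := by linarith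
    have hd : HasDerivAt (fun y : ℝ => y - 1) 1 y := (hasDerivAt_id y).sub_const 1
    refine ⟨hy1, ?_, hd.inv hy1.ne', ?_, ?_⟩
    · refine hd.congr_deriv ?_
      simp only [gammaRootApprox]
      field_simp
    · refine le_of_eq ?_
      field_simp
      ring
    · have : 0 < y - 1 + a := by linarith
      simp only [inv_eq_one_div]
      rw [div_le_div_iff₀ (by positivity) hy1]
      nlinarith [mul_pos ha hy1]
  | succ n ih =>
    obtain ⟨u, w, h⟩ := ih
    refine ⟨fun y => 1 / (y * (y + a)) + u (y + 1),
      fun y => -(2 * y + a) / (y * (y + a)) ^ 2 + w (y + 1), fun y hy => ?_⟩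
    obtain ⟨h1, h2, h3, h4, h5⟩ := h.step ha (y := y) (by linarith)
    refine ⟨h1, h2, h3, h4, le_trans ?_ h5⟩
    have hy1 : 0 < y - 1 := by linarith
    have hy1a : 0 < y - 1 + a := by linarith
    have hya : 0 < y + a := by linarith
    rw [div_le_div_iff₀ (by positivity) (by positivity)]
    nlinarith

lemma convexOn_gammaRootApprox_succ (ha : 0 < a) (ha1 : a < 1) (n : ℕ) :
    ConvexOn ℝ (Ioi 0) (gammaRootApprox a (n + 1)) := by
  obtain ⟨u, w, h⟩ := exists_isRiccatiOn_gammaRootApprox ha ha1 n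
  have step := fun (y : ℝ) (hy : y ∈ Ioi (0 : ℝ)) => h.step ha hy
  refine convexOn_of_hasDerivWithinAt2_nonneg (convex_Ioi 0)
    (fun y hy => (step y hy).2.1.continuousAt.continuousWithinAt)
    (fun y hy => (step y (interior_subset hy)).2.1.hasDerivWithinAt)
    (fun y hy => ((step y (interior_subset hy)).2.1.mul
      (step y (interior_subset hy)).2.2.1).hasDerivWithinAt) fun y hy => ?_
  obtain ⟨h1, -, -, h4, -⟩ := step y (interior_subset hy)
  refine (mul_nonneg h1.le h4).trans_eq ?_
  ring

lemma convexOn_gammaRoot (ha : 0 < a) (ha1 : a < 1) : ConvexOn ℝ (Ioi 0) (gammaRoot a) := by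
  refine ⟨convex_Ioi 0, fun x hx y hy p q hp hq hpq => ?_⟩
  have lim := fun (z : ℝ) (hz : z ∈ Ioi (0 : ℝ)) =>
    (tendsto_gammaRootApprox ha ha1 hz).comp (tendsto_add_atTop_nat 1)
  exact le_of_tendsto_of_tendsto' (lim _ (convex_Ioi 0 hx hy hp hq hpq))
    (((lim x hx).const_smul p).add ((lim y hy).const_smul q))
    fun n => (convexOn_gammaRootApprox_succ ha ha1 n).2 hx hy hp hq hpq

/-- A convex function on a half-line that is bounded above is antitone. -/
lemma ConvexOn.antitoneOn_Ioi_of_le {f : ℝ → ℝ} {b M : ℝ} (hf : ConvexOn ℝ (Ioi b) f)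
    (hM : ∀ x ∈ Ioi b, f x ≤ M) : AntitoneOn f (Ioi b) := by
  intro x hx y hy hxy
  by_contra! hlt
  have hxy' : x < y := lt_of_le_of_ne hxy (by rintro rfl; exact lt_irrefl _ hlt)
  set m := (f y - f x) / (y - x) with hm
  have hmpos : 0 < m := div_pos (by linarith) (by linarith)
  have hMy : 0 ≤ M - f y := sub_nonneg.mpr (hM y hy)
  have hz : 0 < (M - f y) / m + 1 := by positivity
  have hzmem : y + ((M - f y) / m + 1) ∈ Ioi b := by
    have : b < y := hy
    simp only [mem_Ioi]
    linarith
  have key := hf.slope_mono_adjacent hx hzmem hxy' (by linarith)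
  rw [← hm, add_sub_cancel_left, le_div_iff₀ hz] at key
  have h1 : m * ((M - f y) / m + 1) = M - f y + m := by field_simp
  linarith [hM _ hzmem]

/-- `gammaRoot a` does not coincide with a translation on any half-line. -/
lemma not_forall_gammaRoot_eq_add (ha : 0 < a) (ha1 : a < 1) {b : ℝ} (hb : 0 < b) (c : ℝ) :
    ¬ ∀ y, b < y → gammaRoot a y = y + c := by
  intro h
  have poly : ∀ y, b < y → (y + c) * (y + 1 + c) = y * (y + a) := by
    intro y hby
    have hpos : ∀ x, b < x → 0 < x + c := fun x hx => h x hx ▸ gammaRoot_pos ha (hb.trans hx)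
    have hy : 0 < y := hb.trans hby
    have hyc := hpos y hby
    have hyc1 : 0 < y + 1 + c := hpos (y + 1) (by linarith)
    have hya : 0 < y + a := by linarith
    have hleft : HasDerivAt (fun x => x + c) 1 y := (hasDerivAt_id y).add_const c
    have hright := (hasDerivAt_div_add_rpow ha hy).mul
      (((hasDerivAt_id y).add_const 1).add_const c)
    have heq : ∀ x, b < x → x + c = (x / (x + a)) ^ (1 / a) * (x + 1 + c) := by
      intro x hx
      rw [← h x hx, gammaRoot_eq_mul ha (hb.trans hx), h (x + 1) (by linarith)]
    have hev : (fun x => x + c) =ᶠ[𝓝 y] fun x => (x / (x + a)) ^ (1 / a) * (x + 1 + c) := by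
      filter_upwards [eventually_gt_nhds hby] with x hx using heq x hx
    have hd := hleft.unique (hright.congr_of_eventuallyEq hev)
    have hval := heq y hby
    simp only [id] at hd
    set E := (y / (y + a)) ^ (1 / a)
    have hE : E = (y + c) / (y + 1 + c) := by
      rw [hval]; field_simp
    rw [hE] at hd
    field_simp at hd
    linarith
  have h1 := poly (b + 1) (by linarith)
  have h2 := poly (b + 2) (by linarith)
  have hc : 2 * c + 1 = a := by linarith
  subst hc
  have : c * (c + 1) = 0 := by linarith
  nlinarith

lemma strictAntiOn_gammaRoot_sub (ha : 0 < a) (ha1 : a < 1) :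
    StrictAntiOn (fun y => gammaRoot a y - y) (Ioi 0) := by
  have hconv : ConvexOn ℝ (Ioi 0) (fun y => gammaRoot a y - y) :=
    (convexOn_gammaRoot ha ha1).sub (concaveOn_id (convex_Ioi 0))
  have hanti := hconv.antitoneOn_Ioi_of_le (M := 0)
    fun y hy => sub_nonpos.mpr (gammaRoot_le ha ha1 hy)
  intro x hx y hy hxy
  refine lt_of_le_of_ne (hanti hx hy hxy.le) fun heq => ?_
  refine not_forall_gammaRoot_eq_add ha ha1 hy (gammaRoot a y - y) fun z hyz => ?_
  have hz : z ∈ Ioi (0 : ℝ) := lt_trans hy hyz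
  have h1 := hconv.slope_mono_adjacent hx hz hxy hyz
  have h2 := hanti hy hz hyz.le
  simp only at heq h1 h2
  rw [heq, sub_self, zero_div, le_div_iff₀ (by linarith)] at h1
  linarith

lemma convexOn_and_strictAntiOn_of_lt {s t : ℝ} (hst : s < t) (h : t - s < 1) :
    ConvexOn ℝ (Ioi (-s))
        (fun x : ℝ => (Real.Gamma (x + t) / Real.Gamma (x + s)) ^ (1 / (t - s)) - x) ∧
      StrictAntiOn
        (fun x : ℝ => (Real.Gamma (x + t) / Real.Gamma (x + s)) ^ (1 / (t - s)) - x)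
        (Ioi (-s)) := by
  have ha : 0 < t - s := sub_pos.mpr hst
  have hroot : ∀ x, (Real.Gamma (x + t) / Real.Gamma (x + s)) ^ (1 / (t - s)) =
      gammaRoot (t - s) (x + s) := fun x => by
    rw [gammaRoot, show x + s + (t - s) = x + t by ring]
  have hmem : ∀ x ∈ Ioi (-s), x + s ∈ Ioi (0 : ℝ) := fun x hx => by
    simp only [mem_Ioi] at hx ⊢
    linarith
  simp only [hroot]
  constructor
  · have hc := (convexOn_gammaRoot ha h).translate_left s
    exact (hc.subset (fun x hx => by
      have : x + s ∈ Ioi (0 : ℝ) := hmem x hx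
      simpa only [mem_preimage, add_comm s] using this) (convex_Ioi _)).sub
      (concaveOn_id (convex_Ioi _))
  · intro x hx y hy hxy
    have := strictAntiOn_gammaRoot_sub ha h (hmem x hx) (hmem y hy) (by linarith)
    simp only at this ⊢
    linarith

end

/-- For `s ≠ t` with `|t − s| < 1`, the function
`z_{s,t}(x) = [Γ(x+t)/Γ(x+s)]^{1/(t−s)} − x` is convex and strictly decreasing
on `(−min{s,t}, ∞)`. -/
theorem z_convex_and_decreasing (s t : ℝ) (hst : s ≠ t) (h : |t - s| < 1) :
    ConvexOn ℝ (Set.Ioi (-(min s t)))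
        (fun x : ℝ => (Real.Gamma (x + t) / Real.Gamma (x + s)) ^ (1 / (t - s)) - x) ∧
      StrictAntiOn
        (fun x : ℝ => (Real.Gamma (x + t) / Real.Gamma (x + s)) ^ (1 / (t - s)) - x)
        (Set.Ioi (-(min s t))) := by
  rcases lt_or_gt_of_ne hst with hlt | hlt
  · rw [min_eq_left hlt.le]
    exact convexOn_and_strictAntiOn_of_lt hlt (lt_of_abs_lt h)
  · rw [min_eq_right hlt.le]
    have heq : EqOn
        (fun x : ℝ => (Real.Gamma (x + s) / Real.Gamma (x + t)) ^ (1 / (s - t)) - x)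
        (fun x : ℝ => (Real.Gamma (x + t) / Real.Gamma (x + s)) ^ (1 / (t - s)) - x)
        (Ioi (-t)) := fun x _ => by
      simp only
      rw [← neg_sub s t, one_div_neg_eq_neg_one_div, Real.rpow_neg_eq_inv_rpow, inv_div]
    obtain ⟨hconv, hanti⟩ :=
      convexOn_and_strictAntiOn_of_lt hlt (lt_of_abs_lt (abs_sub_comm t s ▸ h))
    exact ⟨hconv.congr heq, hanti.congr heq⟩
end

section
/- Let s, t be real numbers with |t − s| > 1, and let α = min{s, t}. Then the function z_{s,t}(x) = [Γ(x+t)/Γ(x+s)]^{1/(t−s)} − x is concave and (strictly) increasing on the interval (−α, ∞). -/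
open Real Set Filter Topology

/-- A telescoping majorant for `∑ 1 / ((y + k) (y + k + d))`. -/
lemma one_div_mul_add_le_telescope {d y : ℝ} (hd : 1 ≤ d) (hy : 0 < y) :
    1 / (y * (y + d)) + (2 * (y + 1) + d + 1) / (2 * ((y + 1) * (y + 1 + d))) ≤
      (2 * y + d + 1) / (2 * (y * (y + d))) := by
  have hd0 : 0 < d := by linarith
  have key : (2 * y + d + 1) / (2 * (y * (y + d))) -
      (1 / (y * (y + d)) + (2 * (y + 1) + d + 1) / (2 * ((y + 1) * (y + 1 + d)))) =
      (d ^ 2 - 1) / (2 * (y * (y + d) * ((y + 1) * (y + 1 + d)))) := by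
    field_simp
    ring
  have : 0 ≤ (d ^ 2 - 1) / (2 * (y * (y + d) * ((y + 1) * (y + 1 + d)))) :=
    div_nonneg (by nlinarith) (by positivity)
  linarith

lemma sum_one_div_mul_add_le {d : ℝ} (hd : 1 ≤ d) (n : ℕ) {y : ℝ} (hy : 0 < y) :
    ∑ k ∈ Finset.range n, 1 / ((y + k) * (y + k + d)) ≤
      (2 * y + d + 1) / (2 * (y * (y + d))) := by
  induction n generalizing y with
  | zero =>
    have hd0 : 0 < d := by linarith
    simp only [Finset.range_zero, Finset.sum_empty]
    positivity
  | succ n ih =>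
    have h := ih (y := y + 1) (by linarith)
    rw [Finset.sum_range_succ']
    simp only [Nat.cast_add, Nat.cast_one, Nat.cast_zero, add_zero, add_assoc, add_comm (1 : ℝ)]
      at h ⊢
    have := one_div_mul_add_le_telescope hd hy
    simp only [add_assoc, add_comm (1 : ℝ)] at this
    linarith

lemma sq_sum_one_div_mul_add_le {d : ℝ} (hd : 1 ≤ d) (n : ℕ) {y : ℝ} (hy : 0 < y) :
    (∑ k ∈ Finset.range n, 1 / ((y + k) * (y + k + d))) ^ 2 ≤
      ∑ k ∈ Finset.range n, (2 * (y + k) + d) / ((y + k) * (y + k + d)) ^ 2 := by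
  induction n generalizing y with
  | zero => simp
  | succ n ih =>
    have h := ih (y := y + 1) (by linarith)
    have hA := sum_one_div_mul_add_le hd n (y := y + 1) (by linarith)
    have htel := one_div_mul_add_le_telescope hd hy
    rw [Finset.sum_range_succ', Finset.sum_range_succ']
    have e : ∀ k : ℕ, y + ((k + 1 : ℕ) : ℝ) = y + 1 + k := fun k => by push_cast; ring
    simp only [e, Nat.cast_zero, add_zero]
    set A := ∑ k ∈ Finset.range n, 1 / ((y + 1 + k) * (y + 1 + k + d))
    have hd0 : 0 < d := by linarith
    have hp : 0 < y * (y + d) := by positivity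
    have hA' : 2 * A + 1 / (y * (y + d)) ≤ (2 * y + d) / (y * (y + d)) := by
      have e1 : 2 * ((2 * y + d + 1) / (2 * (y * (y + d)))) =
          (2 * y + d) / (y * (y + d)) + 1 / (y * (y + d)) := by
        field_simp
      linarith
    have hmul := mul_le_mul_of_nonneg_left hA' (one_div_pos.2 hp).le
    have e2 : (2 * y + d) / (y * (y + d)) ^ 2 =
        1 / (y * (y + d)) * ((2 * y + d) / (y * (y + d))) := by
      field_simp
    rw [e2]
    nlinarith

lemma concaveOn_exp_sum_log {d : ℝ} (hd : 1 ≤ d) (c : ℝ) (n : ℕ) :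
    ConcaveOn ℝ (Ioi 0) fun x : ℝ =>
      exp (c + 1 / d * ∑ k ∈ Finset.range n, (log (x + k) - log (x + k + d))) := by
  have hd0 : 0 < d := by linarith
  set G : ℝ → ℝ := fun x => c + 1 / d * ∑ k ∈ Finset.range n, (log (x + k) - log (x + k + d))
  set u : ℝ → ℝ := fun x => ∑ k ∈ Finset.range n, 1 / ((x + k) * (x + k + d))
  set v : ℝ → ℝ := fun x => ∑ k ∈ Finset.range n, (2 * (x + k) + d) / ((x + k) * (x + k + d)) ^ 2
  have hG : ∀ x ∈ Ioi (0 : ℝ), HasDerivAt G (u x) x := by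
    intro x hx
    have hx : 0 < x := hx
    have : HasDerivAt G (1 / d * ∑ k ∈ Finset.range n, (1 / (x + k) - 1 / (x + k + d))) x := by
      refine ((HasDerivAt.fun_sum fun k _ => ?_).const_mul _).const_add _
      exact (((hasDerivAt_id x).add_const _).log (by simp; positivity)).sub
        ((((hasDerivAt_id x).add_const _).add_const _).log (by simp; positivity))
    convert! this using 1
    rw [Finset.mul_sum]
    refine Finset.sum_congr rfl fun k _ => ?_
    field_simp
    ring
  have hu : ∀ x ∈ Ioi (0 : ℝ), HasDerivAt u (-v x) x := by
    intro x hx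
    have hx : 0 < x := hx
    simp only [v, ← Finset.sum_neg_distrib]
    refine HasDerivAt.fun_sum fun k _ => ?_
    have hp : HasDerivAt (fun x : ℝ => (x + k) * (x + k + d)) (2 * (x + k) + d) x := by
      convert! ((hasDerivAt_id x).add_const (k : ℝ)).mul
        (((hasDerivAt_id x).add_const (k : ℝ)).add_const d) using 1
      simp
      ring
    convert! hp.fun_inv (by positivity) using 1
    · simp
    · ring
  have hF : ∀ x ∈ Ioi (0 : ℝ), HasDerivAt (fun x => exp (G x)) (exp (G x) * u x) x :=
    fun x hx => (hG x hx).exp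
  refine concaveOn_of_hasDerivWithinAt2_nonpos (convex_Ioi 0)
    (fun x hx => (hF x hx).continuousAt.continuousWithinAt)
    (f' := fun x => exp (G x) * u x)
    (f'' := fun x => exp (G x) * u x * u x + exp (G x) * (-v x)) ?_ ?_ ?_
  all_goals rw [interior_Ioi]; intro x hx
  · exact (hF x hx).hasDerivWithinAt
  · exact ((hF x hx).mul (hu x hx)).hasDerivWithinAt
  · have := sq_sum_one_div_mul_add_le hd n (mem_Ioi.1 hx)
    have := mul_nonneg (exp_pos (G x)).le (sub_nonneg.2 this)
    simp only [v, u] at *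
    nlinarith

lemma ConcaveOn.of_tendsto {s : Set ℝ} {F : ℕ → ℝ → ℝ} {f : ℝ → ℝ}
    (hF : ∀ n, ConcaveOn ℝ s (F n)) (h : ∀ x ∈ s, Tendsto (fun n => F n x) atTop (𝓝 (f x))) :
    ConcaveOn ℝ s f := by
  refine ⟨(hF 0).1, fun x hx y hy a b ha hb hab => ?_⟩
  exact le_of_tendsto_of_tendsto' (((h x hx).const_smul a).add ((h y hy).const_smul b))
    (h _ ((hF 0).1 hx hy ha hb hab)) fun n => (hF n).2 hx hy ha hb hab

lemma Gamma_div_Gamma_rpow_eq_exp {d x : ℝ} (hd : 0 < d) (hx : 0 < x) :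
    (Gamma (x + d) / Gamma x) ^ (1 / d) = exp (1 / d * (log (Gamma (x + d)) - log (Gamma x))) := by
  have h1 := Gamma_pos_of_pos hx
  have h2 := Gamma_pos_of_pos (add_pos hx hd)
  rw [rpow_def_of_pos (div_pos h2 h1), log_div h2.ne' h1.ne', mul_comm]

lemma concaveOn_Gamma_div_Gamma_rpow {d : ℝ} (hd : 1 ≤ d) :
    ConcaveOn ℝ (Ioi 0) fun x : ℝ => (Gamma (x + d) / Gamma x) ^ (1 / d) := by
  have hd0 : 0 < d := by linarith
  refine ConcaveOn.of_tendsto (fun n => concaveOn_exp_sum_log hd (log n) (n + 1)) fun x hx => ?_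
  have hx : 0 < x := hx
  rw [Gamma_div_Gamma_rpow_eq_exp hd0 hx]
  refine (continuous_exp.tendsto _).comp ?_
  convert ((BohrMollerup.tendsto_log_gamma (add_pos hx hd0)).sub
    (BohrMollerup.tendsto_log_gamma hx)).const_mul (1 / d) using 2 with n
  simp only [BohrMollerup.logGammaSeq, Finset.sum_sub_distrib, add_right_comm x _ d]
  field_simp
  ring

lemma le_Gamma_div_Gamma_rpow {d x : ℝ} (hd : 1 < d) (hx : 0 < x) :
    x ≤ (Gamma (x + d) / Gamma x) ^ (1 / d) := by
  have hd0 : 0 < d := by linarith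
  have h := convexOn_log_Gamma.slope_mono_adjacent (x := x) (y := x + 1) (z := x + d)
    hx (mem_Ioi.2 (by linarith)) (by linarith) (by linarith)
  simp only [Function.comp_apply] at h
  rw [Gamma_add_one hx.ne', log_mul hx.ne' (Gamma_pos_of_pos hx).ne', add_sub_cancel_left, div_one,
    le_div_iff₀ (by linarith)] at h
  rw [Gamma_div_Gamma_rpow_eq_exp hd0 hx, ← log_le_iff_le_exp hx, one_div, ← div_eq_inv_mul,
    le_div_iff₀ hd0]
  linarith

/-- A concave function on a half-line that is nonnegative there is monotone. -/
lemma ConcaveOn.monotoneOn_of_nonneg {f : ℝ → ℝ} {a : ℝ} (hf : ConcaveOn ℝ (Ioi a) f)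
    (h0 : ∀ x ∈ Ioi a, 0 ≤ f x) : MonotoneOn f (Ioi a) := by
  intro x hx y hy hxy
  by_contra! hlt
  have hxy : x < y := hxy.lt_of_ne fun h => by simp [h] at hlt
  have hm : 0 < f x - f y := by linarith
  have hpos : 0 < (f y + 1) * (y - x) / (f x - f y) :=
    div_pos (mul_pos (by linarith [h0 y hy]) (by linarith)) hm
  set w := y + (f y + 1) * (y - x) / (f x - f y) with hw
  have hwa : w ∈ Ioi a := mem_Ioi.2 (by linarith [mem_Ioi.1 hy])
  have h := hf.slope_anti_adjacent hx hwa hxy (by linarith)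
  rw [div_le_div_iff₀ (by linarith) (by linarith), hw, add_sub_cancel_left, ← hw] at h
  have e : (f y - f x) * ((f y + 1) * (y - x) / (f x - f y)) = -(f y + 1) * (y - x) := by
    field_simp
    ring
  rw [e] at h
  have := le_of_mul_le_mul_right h (by linarith)
  linarith [h0 w hwa]

/-- `[Γ(x+d)/Γ(x)]^{1/d}` is not of the form `x + c` on any half-line unless `d = 1`. -/
lemma not_forall_Gamma_div_Gamma_rpow_eq {d : ℝ} (hd : 1 < d) {a c : ℝ} (ha : 0 < a) (hc : 0 ≤ c)
    (h : ∀ x, a ≤ x → (Gamma (x + d) / Gamma x) ^ (1 / d) = x + c) : False := by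
  have hd0 : 0 < d := by linarith
  have hlog : ∀ x, a ≤ x → log (Gamma (x + d)) - log (Gamma x) = d * log (x + c) := by
    intro x hx
    rw [← h x hx, Gamma_div_Gamma_rpow_eq_exp hd0 (by linarith), log_exp]
    field_simp
  have hfun : ∀ x, a ≤ x →
      d * log (x + 1 + c) - d * log (x + c) - (log (x + d) - log x) = 0 := by
    intro x hx
    have hx0 : 0 < x := by linarith
    have h1 := hlog x hx
    have h2 := hlog (x + 1) (by linarith)
    rw [Gamma_add_one hx0.ne', log_mul hx0.ne' (Gamma_pos_of_pos hx0).ne', add_right_comm,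
      Gamma_add_one (by positivity), log_mul (by positivity) (Gamma_pos_of_pos (by positivity)).ne']
      at h2
    linarith
  have hquad : ∀ x, a < x → (x + c) * (x + 1 + c) = x * (x + d) := by
    intro x hx
    have hx0 : 0 < x := by linarith
    have hder : HasDerivAt
        (fun x => d * log (x + 1 + c) - d * log (x + c) - (log (x + d) - log x))
        (d * (1 / (x + 1 + c)) - d * (1 / (x + c)) - (1 / (x + d) - 1 / x)) x := by
      have hl : ∀ b : ℝ, 0 ≤ b → HasDerivAt (fun x => log (x + b)) (1 / (x + b)) x := fun b hb =>
        ((hasDerivAt_id x).add_const b).log (by simp; positivity)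
      have h1 := hl (1 + c) (by positivity)
      have h0 := hl 0 le_rfl
      simp only [← add_assoc, add_zero] at h1 h0
      exact ((h1.const_mul d).sub ((hl c hc).const_mul d)).sub ((hl d hd0.le).sub h0)
    have hzero : HasDerivAt
        (fun x => d * log (x + 1 + c) - d * log (x + c) - (log (x + d) - log x)) 0 x :=
      (hasDerivAt_const x (0 : ℝ)).congr_of_eventuallyEq <| by
        filter_upwards [lt_mem_nhds hx] with y hy using hfun y hy.le
    have e := hder.unique hzero
    have hx1 : 0 < x + c := by positivity
    have hx2 : 0 < x + 1 + c := by positivity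
    have hx3 : 0 < x + d := by positivity
    field_simp at e
    have : d * ((x + c) * (x + 1 + c) - x * (x + d)) = 0 := by linarith
    have := (mul_eq_zero.1 this).resolve_left hd0.ne'
    linarith
  have h1 := hquad (a + 1) (by linarith)
  have h2 := hquad (a + 2) (by linarith)
  have hdc : d = 2 * c + 1 := by linarith
  subst hdc
  nlinarith

lemma concaveOn_and_strictMonoOn_Gamma_div_Gamma_rpow_sub {d : ℝ} (hd : 1 < d) :
    ConcaveOn ℝ (Ioi 0) (fun x : ℝ => (Gamma (x + d) / Gamma x) ^ (1 / d) - x) ∧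
      StrictMonoOn (fun x : ℝ => (Gamma (x + d) / Gamma x) ^ (1 / d) - x) (Ioi 0) := by
  set z : ℝ → ℝ := fun x => (Gamma (x + d) / Gamma x) ^ (1 / d) - x
  have hconc : ConcaveOn ℝ (Ioi 0) z :=
    (concaveOn_Gamma_div_Gamma_rpow hd.le).sub (convexOn_id (convex_Ioi 0))
  have hz0 : ∀ x ∈ Ioi (0 : ℝ), 0 ≤ z x := fun x hx =>
    sub_nonneg.2 (le_Gamma_div_Gamma_rpow hd hx)
  have hmono := hconc.monotoneOn_of_nonneg hz0
  refine ⟨hconc, fun x hx y hy hxy => (hmono hx hy hxy.le).lt_of_ne fun heq => ?_⟩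
  refine not_forall_Gamma_div_Gamma_rpow_eq hd hy (hz0 y hy) fun w hw => ?_
  suffices z w = z y by simp only [z] at this ⊢; linarith
  rcases hw.eq_or_lt with rfl | hw
  · rfl
  have hw0 : w ∈ Ioi (0 : ℝ) := mem_Ioi.2 (lt_trans hy hw)
  refine le_antisymm ?_ (hmono hy hw0 hw.le)
  have h := hconc.slope_anti_adjacent hx hw0 hxy hw
  rw [heq, sub_self, zero_div, div_le_iff₀ (by linarith)] at h
  linarith

/-- For `|t − s| > 1`, the function
`z_{s,t}(x) = [Γ(x+t)/Γ(x+s)]^{1/(t−s)} − x` is concave and strictly increasing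
on `(−min{s,t}, ∞)`. -/
theorem z_concave_and_increasing (s t : ℝ) (h : |t - s| > 1) :
    ConcaveOn ℝ (Set.Ioi (-(min s t)))
        (fun x : ℝ => (Real.Gamma (x + t) / Real.Gamma (x + s)) ^ (1 / (t - s)) - x) ∧
      StrictMonoOn
        (fun x : ℝ => (Real.Gamma (x + t) / Real.Gamma (x + s)) ^ (1 / (t - s)) - x)
        (Set.Ioi (-(min s t))) := by
  wlog hst : s ≤ t generalizing s t with H
  · have hts : t < s := not_le.1 hst
    have h' := H t s (by rwa [abs_sub_comm]) hts.le
    have hset : Ioi (-(min t s)) = Ioi (-(min s t)) := by rw [min_comm]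
    rw [hset] at h'
    have heq : EqOn (fun x : ℝ => (Gamma (x + s) / Gamma (x + t)) ^ (1 / (s - t)) - x)
        (fun x : ℝ => (Gamma (x + t) / Gamma (x + s)) ^ (1 / (t - s)) - x)
        (Ioi (-(min s t))) := by
      intro x hx
      rw [min_eq_right hts.le, mem_Ioi] at hx
      have h1 := Gamma_pos_of_pos (show 0 < x + s by linarith)
      have h2 := Gamma_pos_of_pos (show 0 < x + t by linarith)
      simp only
      rw [← inv_div (Gamma (x + t)), inv_rpow (div_pos h2 h1).le, ← rpow_neg (div_pos h2 h1).le,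
        ← neg_sub t s, one_div_neg_eq_neg_one_div, neg_neg]
    exact ⟨h'.1.congr heq, h'.2.congr heq⟩
  · rw [abs_of_nonneg (by linarith)] at h
    rw [min_eq_left hst]
    obtain ⟨hc, hm⟩ := concaveOn_and_strictMonoOn_Gamma_div_Gamma_rpow_sub h
    have hset : (fun x => s + x) ⁻¹' Ioi 0 = Ioi (-s) := by
      ext x
      simp only [mem_preimage, mem_Ioi]
      constructor <;> intro hx <;> linarith
    have e : ∀ x : ℝ, x + s + (t - s) = x + t := fun x => by ring
    constructor
    · have hc' := (hc.translate_left s).add_const s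
      rw [hset] at hc'
      refine hc'.congr fun x _ => ?_
      simp only [Function.comp_apply, Pi.add_apply, e]
      ring
    · intro x hx y hy hxy
      have := hm (a := x + s) (b := y + s) (mem_Ioi.2 (by linarith [mem_Ioi.1 hx]))
        (mem_Ioi.2 (by linarith [mem_Ioi.1 hy])) (by linarith)
      simp only [e] at this ⊢
      linarith
end

section
/- For every positive integer n, the double inequality 1/√(π(n + 4/π − 1)) ≤ (2n−1)!!/(2n)!! < 1/√(π(n + 1/4)) holds, with equality on the left when n = 1. -/
open Nat Real

/-- The squared reciprocal of `(2n-1)‼ / (2n)‼`, expressed through the Wallis product. -/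
noncomputable def wallisSq (n : ℕ) : ℝ := Wallis.W n * (2 * n + 1)

lemma wallisSq_pos (n : ℕ) : 0 < wallisSq n :=
  mul_pos (Wallis.W_pos n) (by positivity)

lemma wallisSq_succ (n : ℕ) :
    wallisSq (n + 1) = wallisSq n * ((2 * n + 2) / (2 * n + 1)) ^ 2 := by
  unfold wallisSq
  rw [Wallis.W_succ]
  push_cast
  field_simp
  ring

lemma wallisSq_one : wallisSq 1 = 4 := by
  rw [wallisSq_succ 0]
  norm_num [wallisSq, Wallis.W]

lemma doubleFactorial_ratio_eq (n : ℕ) :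
    (Nat.doubleFactorial (2 * n - 1) : ℝ) / (Nat.doubleFactorial (2 * n)) =
      1 / Real.sqrt (wallisSq n) := by
  induction n with
  | zero => simp [wallisSq, Wallis.W]
  | succ n ih =>
    rw [wallisSq_succ, Real.sqrt_mul (wallisSq_pos n).le, Real.sqrt_sq (by positivity),
      show 2 * (n + 1) - 1 = 2 * n + 1 by omega, show 2 * (n + 1) = 2 * n + 2 by ring,
      Nat.doubleFactorial_add_one, Nat.doubleFactorial_add_two, one_div, mul_inv, ← one_div, ← ih]
    push_cast
    field_simp

lemma tendsto_two_mul_add_one_div_add (r : ℝ) :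
    Filter.Tendsto (fun n : ℕ => (2 * (n : ℝ) + 1) / (n + r)) Filter.atTop (nhds 2) := by
  simpa [add_comm] using tendsto_add_mul_div_add_mul_atTop_nhds (1 : ℝ) r 2 one_ne_zero

lemma tendsto_wallisSq_div_add (r : ℝ) :
    Filter.Tendsto (fun n : ℕ => wallisSq n / (n + r)) Filter.atTop (nhds π) := by
  have h := Wallis.tendsto_W_nhds_pi_div_two.mul (tendsto_two_mul_add_one_div_add r)
  rw [div_mul_cancel₀ π two_ne_zero] at h
  simpa only [wallisSq, mul_div_assoc] using h

lemma strictAnti_wallisSq_div :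
    StrictAnti (fun n : ℕ => wallisSq n / (n + 1 / 4)) := by
  refine strictAnti_nat_of_succ_lt fun n => ?_
  have h := wallisSq_pos n
  rw [wallisSq_succ, mul_div_assoc, div_eq_mul_inv (wallisSq n)]
  refine mul_lt_mul_of_pos_left ?_ h
  rw [div_pow, div_div, ← one_div, div_lt_div_iff₀ (by positivity) (by positivity)]
  push_cast
  nlinarith

lemma pi_mul_lt_wallisSq (n : ℕ) : π * (n + 1 / 4) < wallisSq n := by
  rw [← lt_div_iff₀ (by positivity)]
  exact (strictAnti_wallisSq_div.antitone.le_of_tendsto (tendsto_wallisSq_div_add _) (n + 1)).trans_lt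
    (strictAnti_wallisSq_div n.lt_succ_self)

lemma monotone_wallisSq_mul_div :
    Monotone (fun n : ℕ => wallisSq n * ((4 * n + 3) / (2 * n + 1) ^ 2)) := by
  refine monotone_nat_of_le_succ fun n => ?_
  rw [wallisSq_succ, mul_assoc]
  refine mul_le_mul_of_nonneg_left ?_ (wallisSq_pos n).le
  rw [div_pow, _root_.div_mul_div_comm, div_le_div_iff₀ (by positivity) (by positivity)]
  push_cast
  have h : (0 : ℝ) ≤ (2 * n + 1) ^ 2 := by positivity
  linear_combination h

lemma wallisSq_mul_div_le_pi (n : ℕ) :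
    wallisSq n * ((4 * n + 3) / (2 * n + 1) ^ 2) ≤ π := by
  refine monotone_wallisSq_mul_div.ge_of_tendsto ?_ n
  have h₁ : Filter.Tendsto (fun n : ℕ => (4 * (n : ℝ) + 3) / (2 * n + 1)) Filter.atTop
      (nhds 2) := by
    have := tendsto_add_mul_div_add_mul_atTop_nhds (3 : ℝ) 1 4 (two_ne_zero (α := ℝ))
    norm_num at this
    simpa [add_comm] using this
  have h := Wallis.tendsto_W_nhds_pi_div_two.mul h₁
  rw [div_mul_cancel₀ π two_ne_zero] at h
  refine h.congr fun n => ?_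
  unfold wallisSq
  field_simp

lemma wallisSq_le (n : ℕ) (hn : 0 < n) : wallisSq n ≤ π * (n + 4 / π - 1) := by
  induction n, hn using Nat.le_induction with
  | base =>
    rw [wallisSq_one]
    apply le_of_eq
    field_simp
    norm_num
  | succ n _ ih =>
    have h : wallisSq (n + 1) =
        wallisSq n + wallisSq n * ((4 * n + 3) / (2 * n + 1) ^ 2) := by
      rw [wallisSq_succ]
      field_simp
      ring
    have := wallisSq_mul_div_le_pi n
    push_cast
    linarith

/-- For every positive integer `n`,
`1/√(π(n + 4/π − 1)) ≤ (2n−1)!!/(2n)!! < 1/√(π(n + 1/4))`,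
with equality on the left when `n = 1`. -/
theorem wallis_ratio_bounds :
    (∀ n : ℕ, 0 < n →
      1 / Real.sqrt (π * (n + 4 / π - 1)) ≤
          (Nat.doubleFactorial (2 * n - 1) : ℝ) / (Nat.doubleFactorial (2 * n)) ∧
        (Nat.doubleFactorial (2 * n - 1) : ℝ) / (Nat.doubleFactorial (2 * n)) <
          1 / Real.sqrt (π * (n + 1 / 4))) ∧
    1 / Real.sqrt (π * (1 + 4 / π - 1)) =
      (Nat.doubleFactorial (2 * 1 - 1) : ℝ) / (Nat.doubleFactorial (2 * 1)) := by
  refine ⟨fun n hn => ?_, ?_⟩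
  · rw [doubleFactorial_ratio_eq]
    exact ⟨one_div_le_one_div_of_le (Real.sqrt_pos.2 (wallisSq_pos n))
        (Real.sqrt_le_sqrt (wallisSq_le n hn)),
      one_div_lt_one_div_of_lt (Real.sqrt_pos.2 (by positivity))
        (Real.sqrt_lt_sqrt (by positivity) (pi_mul_lt_wallisSq n))⟩
  · rw [doubleFactorial_ratio_eq, wallisSq_one, add_sub_cancel_left,
      mul_div_cancel₀ _ Real.pi_ne_zero]
end

section
/- For every positive integer n, the double inequality √π/(2√(n + 9π/16 − 1)) ≤ (2n)!!/(2n+1)!! < √π/(2√(n + 3/4)) holds, with equality on the left when n = 1. -/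
open Nat Real

namespace Real.Wallis

open Filter Topology

theorem W_mul_doubleFactorial_sq (n : ℕ) :
    W n * ((2 * n + 1).doubleFactorial : ℝ) ^ 2 =
      (2 * n + 1) * ((2 * n).doubleFactorial : ℝ) ^ 2 := by
  induction n with
  | zero => simp [W]
  | succ n ih =>
    have h1 : (2 * (n + 1)).doubleFactorial = (2 * n + 2) * (2 * n).doubleFactorial :=
      Nat.doubleFactorial_add_two _
    have h2 : (2 * (n + 1) + 1).doubleFactorial = (2 * n + 3) * (2 * n + 1).doubleFactorial :=
      Nat.doubleFactorial_add_two _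
    rw [W_succ, h1, h2]
    push_cast
    calc _ = (2 * (n : ℝ) + 2) ^ 2 * (2 * n + 3) / (2 * n + 1) *
          (W n * ((2 * n + 1).doubleFactorial : ℝ) ^ 2) := by field_simp
      _ = _ := by rw [ih]; field_simp; ring

theorem doubleFactorial_ratio_sq (n : ℕ) :
    (((2 * n).doubleFactorial : ℝ) / (2 * n + 1).doubleFactorial) ^ 2 = W n / (2 * n + 1) := by
  have h : ((2 * n + 1).doubleFactorial : ℝ) ≠ 0 :=
    mod_cast (Nat.doubleFactorial_pos _).ne'
  rw [div_pow, div_eq_div_iff (by positivity) (by positivity)]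
  linear_combination -W_mul_doubleFactorial_sq n

theorem tendsto_natCast_add_div (a b : ℝ) {c : ℝ} (hc : c ≠ 0) :
    Tendsto (fun n : ℕ => ((n : ℝ) + a) / (c * n + b)) atTop (𝓝 c⁻¹) := by
  have h (d : ℝ) : Tendsto (fun n : ℕ => d / (n : ℝ)) atTop (𝓝 0) :=
    tendsto_const_div_atTop_nhds_zero_nat d
  have h' : Tendsto (fun n : ℕ => (1 + a / (n : ℝ)) / (c + b / n)) atTop
      (𝓝 ((1 + 0) / (c + 0))) :=
    (tendsto_const_nhds.add (h a)).div (tendsto_const_nhds.add (h b)) (by simpa using hc)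
  rw [add_zero, add_zero, one_div] at h'
  refine h'.congr' ?_
  filter_upwards [eventually_ne_atTop 0] with n hn
  have hn' : (n : ℝ) ≠ 0 := mod_cast hn
  rw [← mul_div_mul_right _ _ hn', add_mul, add_mul, div_mul_cancel₀ _ hn',
    div_mul_cancel₀ _ hn', one_mul]

theorem W_mul_lt (n : ℕ) : W n / (2 * n + 1) * (n + 3 / 4) < π / 4 := by
  have hmono : StrictMono fun n : ℕ => W n * (((n : ℝ) + 3 / 4) / (2 * n + 1)) := by
    refine strictMono_nat_of_lt_succ fun n => ?_
    rw [W_succ, mul_assoc]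
    refine mul_lt_mul_of_pos_left ?_ (W_pos n)
    push_cast
    rw [← sub_pos]
    have : (2 * (n : ℝ) + 2) / (2 * n + 1) * ((2 * n + 2) / (2 * n + 3)) *
          ((n + 1 + 3 / 4) / (2 * (n + 1) + 1)) - (n + 3 / 4) / (2 * n + 1) =
        1 / (4 * (2 * n + 1) * (2 * n + 3) ^ 2) := by
      rw [show (2 * ((n : ℝ) + 1) + 1) = 2 * n + 3 by ring]
      field_simp
      ring
    rw [this]
    positivity
  have hlim : Tendsto (fun n : ℕ => W n * (((n : ℝ) + 3 / 4) / (2 * n + 1))) atTop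
      (𝓝 (π / 4)) := by
    convert tendsto_W_nhds_pi_div_two.mul
      (tendsto_natCast_add_div (3 / 4) 1 (two_ne_zero (α := ℝ))) using 2
    ring
  calc W n / (2 * n + 1) * (n + 3 / 4) = W n * (((n : ℝ) + 3 / 4) / (2 * n + 1)) := by ring
    _ < _ := hmono n.lt_succ_self
    _ ≤ π / 4 := hmono.monotone.ge_of_tendsto hlim _

theorem pi_div_four_le_W_mul (n : ℕ) :
    π / 4 ≤ W n * (((n : ℝ) + 1) / (2 * n + 1) * (4 * ((n + 1) / (4 * n + 5)))) := by
  have hanti : Antitone fun n : ℕ =>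
      W n * (((n : ℝ) + 1) / (2 * n + 1) * (4 * ((n + 1) / (4 * n + 5)))) := by
    refine antitone_nat_of_succ_le fun n => ?_
    rw [W_succ, mul_assoc]
    refine mul_le_mul_of_nonneg_left ?_ (W_pos n).le
    push_cast
    rw [← sub_nonneg]
    have : ((n : ℝ) + 1) / (2 * n + 1) * (4 * ((n + 1) / (4 * n + 5))) -
        (2 * n + 2) / (2 * n + 1) * ((2 * n + 2) / (2 * n + 3)) *
          ((n + 1 + 1) / (2 * (n + 1) + 1) * (4 * ((n + 1 + 1) / (4 * (n + 1) + 5)))) =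
        4 * (n + 1) ^ 2 / ((2 * n + 1) * (4 * n + 5) * (2 * n + 3) ^ 2 * (4 * n + 9)) := by
      rw [show (2 * ((n : ℝ) + 1) + 1) = 2 * n + 3 by ring,
        show (4 * ((n : ℝ) + 1) + 5) = 4 * n + 9 by ring]
      field_simp
      ring
    rw [this]
    positivity
  refine hanti.le_of_tendsto ?_ n
  convert tendsto_W_nhds_pi_div_two.mul
    ((tendsto_natCast_add_div 1 1 (two_ne_zero (α := ℝ))).mul
      ((tendsto_natCast_add_div 1 5 (four_ne_zero (α := ℝ))).const_mul 4)) using 2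
  ring

theorem W_one : W 1 = 4 / 3 := by
  norm_num [W]

theorem pi_div_four_le {n : ℕ} (hn : 0 < n) :
    π / 4 ≤ W n / (2 * n + 1) * (n + 9 * π / 16 - 1) := by
  induction n, hn using Nat.le_induction with
  | base => rw [W_one]; push_cast; apply le_of_eq; ring
  | succ n hn ih =>
    have h := pi_div_four_le_W_mul n
    have h' : π / 4 * ((4 * n + 5) / (2 * n + 3) ^ 2) ≤
        W n / (2 * n + 1) * ((2 * n + 2) / (2 * n + 3)) ^ 2 := by
      calc _ ≤ _ := mul_le_mul_of_nonneg_right h (by positivity)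
        _ = _ := by field_simp; ring
    calc π / 4 = π / 4 * ((2 * n + 2) / (2 * n + 3)) ^ 2 +
          π / 4 * ((4 * n + 5) / (2 * n + 3) ^ 2) := by field_simp; ring
      _ ≤ W n / (2 * n + 1) * (n + 9 * π / 16 - 1) * ((2 * n + 2) / (2 * n + 3)) ^ 2 +
          W n / (2 * n + 1) * ((2 * n + 2) / (2 * n + 3)) ^ 2 := by gcongr
      _ = _ := by
        rw [W_succ]
        push_cast
        rw [show (2 * ((n : ℝ) + 1) + 1) = 2 * n + 3 by ring]
        ring

end Real.Wallis

theorem sqrt_pi_div_two_mul_sqrt (y : ℝ) : √π / (2 * √y) = √(π / 4 / y) := by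
  rw [Real.sqrt_div (by positivity), Real.sqrt_div pi_pos.le,
    show (4 : ℝ) = 2 ^ 2 by norm_num, Real.sqrt_sq zero_le_two, div_div]

/-- For every positive integer `n`,
`√π/(2√(n + 9π/16 − 1)) ≤ (2n)!!/(2n+1)!! < √π/(2√(n + 3/4))`,
with equality on the left when `n = 1`. -/
theorem wallis_type_ratio_bounds :
    (∀ n : ℕ, 0 < n →
      Real.sqrt π / (2 * Real.sqrt (n + 9 * π / 16 - 1)) ≤
          (Nat.doubleFactorial (2 * n) : ℝ) / (Nat.doubleFactorial (2 * n + 1)) ∧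
        (Nat.doubleFactorial (2 * n) : ℝ) / (Nat.doubleFactorial (2 * n + 1)) <
          Real.sqrt π / (2 * Real.sqrt (n + 3 / 4))) ∧
    Real.sqrt π / (2 * Real.sqrt (1 + 9 * π / 16 - 1)) =
      (Nat.doubleFactorial (2 * 1) : ℝ) / (Nat.doubleFactorial (2 * 1 + 1)) := by
  refine ⟨fun n hn => ?_, ?_⟩
  · have hn' : (1 : ℝ) ≤ n := mod_cast hn
    have hpos : 0 < (n : ℝ) + 9 * π / 16 - 1 := by linarith [pi_pos]
    rw [sqrt_pi_div_two_mul_sqrt, sqrt_pi_div_two_mul_sqrt]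
    constructor
    · rw [Real.sqrt_le_left (by positivity), Real.Wallis.doubleFactorial_ratio_sq,
        div_le_iff₀ hpos]
      exact Real.Wallis.pi_div_four_le hn
    · rw [Real.lt_sqrt (by positivity), Real.Wallis.doubleFactorial_ratio_sq,
        lt_div_iff₀ (by positivity)]
      exact Real.Wallis.W_mul_lt n
  · rw [sqrt_pi_div_two_mul_sqrt,
      show π / 4 / (1 + 9 * π / 16 - 1) = (2 / 3) ^ 2 by field_simp; ring,
      Real.sqrt_sq (by norm_num)]
    norm_num [Nat.doubleFactorial]
end

section
/- For every positive integer n, the double inequality √π/√(1 + (9π/16 − 1)/n) ≤ ∫_{−√n}^{√n} e^{−x²} dx < √π/√(1 − 3/(4n)) holds. In particular, letting n → ∞ gives ∫_{−∞}^{∞} e^{−x²} dx = √π. -/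
open Real MeasureTheory

theorem integrable_exp_neg_sq : Integrable (fun x : ℝ => Real.exp (-x ^ 2)) := by
  simpa using integrable_exp_neg_mul_sq (b := 1) one_pos

theorem integral_exp_neg_sq : ∫ x : ℝ, Real.exp (-x ^ 2) = Real.sqrt π := by
  simpa using integral_gaussian 1

theorem integral_exp_neg_sq_eq_add_tail (a : ℝ) :
    (∫ x in (-a)..a, Real.exp (-x ^ 2)) + 2 * ∫ x in Set.Ioi a, Real.exp (-x ^ 2) =
      Real.sqrt π := by
  have hleft : ∫ x in Set.Iic (-a), Real.exp (-x ^ 2) = ∫ x in Set.Ioi a, Real.exp (-x ^ 2) := by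
    have h := integral_comp_neg_Iic (-a) (fun x : ℝ => Real.exp (-x ^ 2))
    simp_rw [neg_sq, neg_neg] at h
    exact h
  have hmid := intervalIntegral.integral_Iic_sub_Iic
    (integrable_exp_neg_sq.integrableOn (s := Set.Iic (-a)))
    (integrable_exp_neg_sq.integrableOn (s := Set.Iic a))
  have hsplit := intervalIntegral.integral_Iic_add_Ioi
    (integrable_exp_neg_sq.integrableOn (s := Set.Iic a))
    (integrable_exp_neg_sq.integrableOn (s := Set.Ioi a))
  rw [integral_exp_neg_sq] at hsplit
  linarith

theorem setIntegral_Ioi_exp_neg_sq_pos (a : ℝ) : 0 < ∫ x in Set.Ioi a, Real.exp (-x ^ 2) := by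
  rw [setIntegral_pos_iff_support_of_nonneg_ae (.of_forall fun x => (Real.exp_pos _).le)
    integrable_exp_neg_sq.integrableOn]
  simp [Function.support, (Real.exp_pos _).ne']

theorem setIntegral_Ioi_exp_neg_sq_le {a : ℝ} (ha : 1 ≤ a) :
    ∫ x in Set.Ioi a, Real.exp (-x ^ 2) ≤ Real.exp (-a ^ 2) / 2 := by
  have hderiv : ∀ x ∈ Set.Ici a,
      HasDerivAt (fun x : ℝ => -Real.exp (-x ^ 2) / 2) (x * Real.exp (-x ^ 2)) x := by
    intro x _
    refine ((hasDerivAt_pow 2 x).fun_neg.exp.fun_neg.div_const 2).congr_deriv ?_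
    push_cast
    ring
  have hnonneg : ∀ x ∈ Set.Ioi a, 0 ≤ x * Real.exp (-x ^ 2) := fun x hx =>
    mul_nonneg (by linarith [Set.mem_Ioi.1 hx]) (Real.exp_pos _).le
  have hlim : Filter.Tendsto (fun x : ℝ => -Real.exp (-x ^ 2) / 2) Filter.atTop (nhds 0) := by
    have h := (Real.tendsto_exp_neg_atTop_nhds_zero.comp
      (Filter.tendsto_pow_atTop (α := ℝ) two_ne_zero)).neg.div_const 2
    simpa using h
  calc ∫ x in Set.Ioi a, Real.exp (-x ^ 2)
      ≤ ∫ x in Set.Ioi a, x * Real.exp (-x ^ 2) := by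
        refine setIntegral_mono_on integrable_exp_neg_sq.integrableOn
          (integrableOn_Ioi_deriv_of_nonneg' hderiv hnonneg hlim) measurableSet_Ioi fun x hx => ?_
        exact le_mul_of_one_le_left (Real.exp_pos _).le (by linarith [Set.mem_Ioi.1 hx])
    _ = Real.exp (-a ^ 2) / 2 := by
        rw [integral_Ioi_of_hasDerivAt_of_nonneg' hderiv hnonneg hlim]
        ring

theorem sqrt_pi_sub_exp_neg_ge {y : ℝ} (hy : 1 ≤ y) :
    Real.sqrt π / Real.sqrt (1 + (9 * π / 16 - 1) / y) ≤ Real.sqrt π - Real.exp (-y) := by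
  obtain ⟨c, hc⟩ : ∃ c, c = 9 * π / 16 - 1 := ⟨_, rfl⟩
  have hc_lower : 0.76 ≤ c := by linarith [Real.pi_gt_d2]
  have hy0 : 0 < y := by linarith
  have hsqrt : 1.77 ≤ Real.sqrt π :=
    Real.le_sqrt_of_sq_le (by linarith [Real.pi_gt_d2])
  have hsq : Real.sqrt π ^ 2 = π := Real.sq_sqrt Real.pi_pos.le
  have hexp : 2.7 * y * Real.exp (-y) ≤ 1 := by
    have h : 2.7 * y ≤ Real.exp y := by
      have h1 : Real.exp y = Real.exp 1 * Real.exp (y - 1) := by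
        rw [← Real.exp_add]; congr 1; ring
      rw [h1]
      exact mul_le_mul (by linarith [Real.exp_one_gt_d9])
        (by linarith [Real.add_one_le_exp (y - 1)]) hy0.le (Real.exp_pos _).le
    calc 2.7 * y * Real.exp (-y) ≤ Real.exp y * Real.exp (-y) := by gcongr
      _ = 1 := by rw [← Real.exp_add]; simp
  have hE := Real.exp_pos (-y)
  rw [← hc, ← Real.sqrt_div Real.pi_pos.le]
  generalize Real.exp (-y) = E at *
  have hyE : E ≤ y * E := le_mul_of_one_le_left hE.le hy
  have hmain : 2 * E * (y + c) ≤ Real.sqrt π * c := by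
    have h1 : 2 * E * (y + c) ≤ (2 + 2 * c) * (y * E) := by nlinarith
    have h2 : (2 + 2 * c) * (y * E) ≤ (2.7 * 1.77 * c) * (y * E) := by
      have : 0 ≤ y * E := by positivity
      gcongr
      linarith
    have h3 : 1.77 * c * (2.7 * y * E) ≤ 1.77 * c * 1 := by gcongr
    have h4 : 1.77 * c ≤ Real.sqrt π * c := by gcongr
    linarith
  have hEle : E ≤ 1 := by linarith
  refine Real.sqrt_le_iff.2 ⟨by linarith, ?_⟩
  rw [show 1 + c / y = (y + c) / y by field_simp, div_div_eq_mul_div, div_le_iff₀ (by linarith)]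
  have h := mul_le_mul_of_nonneg_left hmain (Real.sqrt_nonneg π)
  nlinarith [mul_nonneg (sq_nonneg E) (show 0 ≤ y + c by linarith)]

/-- For every positive integer `n`,
`√π/√(1 + (9π/16 − 1)/n) ≤ ∫_{−√n}^{√n} e^{−x²} dx < √π/√(1 − 3/(4n))`;
in particular `∫_{−∞}^{∞} e^{−x²} dx = √π`. -/
theorem gaussian_integral_bounds :
    (∀ n : ℕ, 0 < n →
      Real.sqrt π / Real.sqrt (1 + (9 * π / 16 - 1) / n) ≤
          (∫ x in (-Real.sqrt n)..(Real.sqrt n), Real.exp (-x ^ 2)) ∧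
        (∫ x in (-Real.sqrt n)..(Real.sqrt n), Real.exp (-x ^ 2)) <
          Real.sqrt π / Real.sqrt (1 - 3 / (4 * n))) ∧
    (∫ x : ℝ, Real.exp (-x ^ 2)) = Real.sqrt π := by
  refine ⟨fun n hn => ?_, integral_exp_neg_sq⟩
  have hn1 : (1 : ℝ) ≤ n := by exact_mod_cast hn
  have htail := integral_exp_neg_sq_eq_add_tail (Real.sqrt n)
  constructor
  · have h := setIntegral_Ioi_exp_neg_sq_le (Real.one_le_sqrt.2 hn1)
    rw [Real.sq_sqrt (by positivity)] at h
    linarith [sqrt_pi_sub_exp_neg_ge hn1]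
  · have hlt : 3 / (4 * (n : ℝ)) < 1 := by
      rw [div_lt_one (by positivity)]
      linarith
    have hle : Real.sqrt π ≤ Real.sqrt π / Real.sqrt (1 - 3 / (4 * n)) := by
      refine le_div_self (Real.sqrt_nonneg _) (Real.sqrt_pos.2 (by linarith)) ?_
      rw [Real.sqrt_le_one]
      linarith [show 0 ≤ 3 / (4 * (n : ℝ)) by positivity]
    linarith [setIntegral_Ioi_exp_neg_sq_pos (Real.sqrt n)]
end
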